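/- Let ω* = p/m with p ∈ ℤ, m ∈ ℕ*, and let f ∈ C^ω(𝕋) have zero mean value. For any formal solution u ∈ ε·C^ω(𝕋)[[ε]] of Δ*u = ε f∘(id+u): the formal series id + Π₀u has a composition inverse (with respect to θ, at fixed ε) of the form id + a with a ∈ ε·V₀[[ε]], and the formula u* := (u − Π₀u)∘(id+a) defines a formal solution of the same equation Δ*u* = ε f∘(id+u*) all of whose coefficients belong to V₀^⊥. -/

import Mathlib

noncomputable section

/-- The orthogonal projection `Π₀` onto `V₀` (frequencies in `mℤ`), realized by
averaging: `Π₀φ(θ) = (1/m)Σ_{j<m} φ(θ+j/m)`. -/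
def P0 (m : ℕ) (φ : ℝ → ℝ) (θ : ℝ) : ℝ :=
  (m : ℝ)⁻¹ * ∑ j ∈ Finset.range m, φ (θ + (j : ℝ) / m)

/-- The coefficient of `ε^n` in the formal composition `Φ∘(id+a)` where
`Φ = Σ_s ε^s φ_s` and `a = Σ_{s≥1} ε^s a_s` (Taylor expansion; terms with some
index `0` vanish since `a 0 = 0`). -/
def compCoeff (φ : ℕ → ℝ → ℝ) (a : ℕ → ℝ → ℝ) (n : ℕ) (θ : ℝ) : ℝ :=
  ∑ s ∈ Finset.range (n + 1), ∑ r ∈ Finset.range (n - s + 1),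
    ((r.factorial : ℝ))⁻¹ * iteratedDeriv r (φ s) θ *
      ∑ c ∈ Finset.Nat.antidiagonalTuple r (n - s), ∏ i, a (c i) θ

/-- The coefficient of `ε^n` in `ε·f∘(id+u)` for `u = Σ_{n≥1} ε^n u_n`. -/
def rhsCoeff (f : ℝ → ℝ) (u : ℕ → ℝ → ℝ) (n : ℕ) (θ : ℝ) : ℝ :=
  ∑ r ∈ Finset.range n, ((r.factorial : ℝ))⁻¹ * iteratedDeriv r f θ *
    ∑ c ∈ Finset.Nat.antidiagonalTuple r (n - 1), ∏ i, u (c i) θ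

section FormalComposition

open PowerSeries Finset

theorem PowerSeries.coeff_pow_eq_sum_antidiagonalTuple {R : Type*} [CommRing R] (F : R⟦X⟧)
    (r n : ℕ) :
    coeff n (F ^ r) = ∑ c ∈ Nat.antidiagonalTuple r n, ∏ i, coeff (c i) F := by
  have h : F ^ r = ∏ _i : Fin r, F := by simp
  rw [h, coeff_prod]
  refine sum_equiv Finsupp.equivFunOnFinite (fun l ↦ ?_) fun l _ ↦ rfl
  simp [mem_finsuppAntidiag, Nat.mem_antidiagonalTuple]

theorem PowerSeries.X_pow_dvd_pow {R : Type*} [CommRing R] {A : R⟦X⟧}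
    (hA : constantCoeff A = 0) (r : ℕ) : (X : R⟦X⟧) ^ r ∣ A ^ r :=
  pow_dvd_pow_of_dvd (X_dvd_iff.2 hA) r

theorem PowerSeries.coeff_pow_eq_zero_of_lt {R : Type*} [CommRing R] {A : R⟦X⟧}
    (hA : constantCoeff A = 0) {n r : ℕ} (h : n < r) : coeff n (A ^ r) = 0 :=
  X_pow_dvd_iff.1 (X_pow_dvd_pow hA r) n h

theorem PowerSeries.coeff_subst_eq_sum_range {R : Type*} [CommRing R] {A : R⟦X⟧}
    (hA : constantCoeff A = 0) (F : R⟦X⟧) {n N : ℕ} (h : n < N) :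
    coeff n (F.subst A) = ∑ r ∈ range N, coeff r F * coeff n (A ^ r) := by
  rw [coeff_subst' (.of_constantCoeff_zero' hA), finsum_eq_sum_of_support_subset (s := range N)]
  · simp
  · intro r hr
    by_contra hrN
    simp only [coe_range, Set.mem_Iio, not_lt] at hrN
    exact hr (by simp [coeff_pow_eq_zero_of_lt hA (h.trans_le hrN)])

theorem PowerSeries.X_pow_dvd_subst_sub {R : Type*} [CommRing R] {A : R⟦X⟧}
    (hA : constantCoeff A = 0) (F : R⟦X⟧) (N : ℕ) :
    (X : R⟦X⟧) ^ N ∣ F.subst A - ∑ r ∈ range N, C (coeff r F) * A ^ r := by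
  refine X_pow_dvd_iff.2 fun n hn ↦ ?_
  simp [coeff_subst_eq_sum_range hA F hn]

/-- The Taylor formula `F(A + V) = ∑ F^{(r)}(A) V^r / r!` modulo `X ^ N`, where `G r` stands for
`F^{(r)} / r!`. -/
theorem PowerSeries.X_pow_dvd_subst_add_sub {R : Type*} [CommRing R] {A V : R⟦X⟧}
    (hA : constantCoeff A = 0) (hV : constantCoeff V = 0) (F : R⟦X⟧) (G : ℕ → R⟦X⟧)
    (hG : ∀ r q, coeff q (G r) = (r + q).choose r * coeff (r + q) F) (N : ℕ) :
    (X : R⟦X⟧) ^ N ∣ F.subst (A + V) - ∑ r ∈ range N, (G r).subst A * V ^ r := by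
  have h₁ : (X : R⟦X⟧) ^ N ∣ ∑ r ∈ range N,
      ((G r).subst A - ∑ q ∈ range (N - r), C (coeff q (G r)) * A ^ q) * V ^ r := by
    refine dvd_sum fun r hr ↦ ?_
    have hrN : N - r + r = N := Nat.sub_add_cancel (mem_range.1 hr).le
    conv_lhs => rw [← hrN, pow_add]
    exact mul_dvd_mul (X_pow_dvd_subst_sub hA _ _) (X_pow_dvd_pow hV r)
  have h₂ := X_pow_dvd_subst_sub (A := A + V) (by simp [hA, hV]) F N
  have h₃ : ∑ k ∈ range N, C (coeff k F) * (A + V) ^ k =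
      ∑ r ∈ range N, (∑ q ∈ range (N - r), C (coeff q (G r)) * A ^ q) * V ^ r := by
    simp_rw [sum_mul]
    rw [← sum_range_diag_flip N fun r q ↦ C (coeff q (G r)) * A ^ q * V ^ r]
    refine sum_congr rfl fun k _ ↦ ?_
    rw [add_comm A V, add_pow, mul_sum]
    refine sum_congr rfl fun r hr ↦ ?_
    rw [hG, Nat.add_sub_cancel' (Nat.lt_succ_iff.1 (mem_range.1 hr))]
    simp only [map_mul, map_natCast]
    ring
  rw [← dvd_sub_left h₁] at h₂
  convert h₂ using 1
  rw [h₃]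
  simp only [sub_mul, sum_sub_distrib]
  ring

/-- The extension of a ring homomorphism `S : B →+* R⟦X⟧` to `B⟦X⟧` mapping `X` to `X`. -/
def PowerSeries.diagHom {B R : Type*} [CommRing B] [CommRing R] (S : B →+* R⟦X⟧) :
    B⟦X⟧ →+* R⟦X⟧ where
  toFun Φ := mk fun n ↦ ∑ p ∈ antidiagonal n, coeff p.2 (S (coeff p.1 Φ))
  map_zero' := by ext; simp
  map_one' := by
    ext n
    rw [coeff_mk, sum_eq_single (0, n)]
    · simp
    · rintro ⟨s, k⟩ h hne
      have : s ≠ 0 := by rintro rfl; simp_all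
      simp [coeff_one, this]
    · simp
  map_add' Φ Ψ := by ext; simp [sum_add_distrib]
  map_mul' Φ Ψ := by
    ext n
    simp only [coeff_mk, coeff_mul, map_sum, map_mul, sum_mul_sum, ← sum_product', sum_sigma']
    refine sum_nbij'
      (fun x ↦ ⟨(x.2.1.1 + x.2.2.1, x.2.1.2 + x.2.2.2), ((x.2.1.1, x.2.2.1), (x.2.1.2, x.2.2.2))⟩)
      (fun x ↦ ⟨(x.2.1.1 + x.2.2.1, x.2.1.2 + x.2.2.2), ((x.2.1.1, x.2.2.1), (x.2.1.2, x.2.2.2))⟩)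
      ?_ ?_ ?_ ?_ ?_
    all_goals
      rintro ⟨⟨s, k⟩, ⟨i, j⟩, ⟨k₁, k₂⟩⟩ h
      simp only [mem_sigma, mem_product, HasAntidiagonal.mem_antidiagonal] at h ⊢
      try obtain ⟨h, rfl, rfl⟩ := h
    · exact ⟨by omega, trivial, trivial⟩
    · exact ⟨by omega, trivial, trivial⟩
    · rfl
    · rfl

theorem PowerSeries.coeff_diagHom {B R : Type*} [CommRing B] [CommRing R] (S : B →+* R⟦X⟧)
    (Φ : B⟦X⟧) (n : ℕ) :
    coeff n (diagHom S Φ) = ∑ p ∈ antidiagonal n, coeff p.2 (S (coeff p.1 Φ)) :=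
  by simp [diagHom]

theorem PowerSeries.diagHom_C {B R : Type*} [CommRing B] [CommRing R] (S : B →+* R⟦X⟧)
    (b : B) : diagHom S (C b) = S b := by
  ext n
  rw [coeff_diagHom, sum_eq_single (0, n)]
  · simp
  · rintro ⟨s, k⟩ h hne
    have : s ≠ 0 := by rintro rfl; simp_all
    simp [coeff_C, this]
  · simp

theorem PowerSeries.diagHom_X {B R : Type*} [CommRing B] [CommRing R] (S : B →+* R⟦X⟧) :
    diagHom S X = X := by
  ext n
  rw [coeff_diagHom, coeff_X]
  split_ifs with h
  · subst h
    simp [Nat.antidiagonal_succ]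
  · refine sum_eq_zero fun p hp ↦ ?_
    rw [HasAntidiagonal.mem_antidiagonal] at hp
    rw [coeff_X]
    split_ifs with h'
    · rw [map_one, coeff_one, if_neg (by omega)]
    · simp

theorem AnalyticAt.iteratedDeriv_real {g : ℝ → ℝ} {x : ℝ} (hg : AnalyticAt ℝ g x) (r : ℕ) :
    AnalyticAt ℝ (iteratedDeriv r g) x := by
  rw [iteratedDeriv_eq_iterate]
  exact hg.iterated_deriv r

/-- The algebra of real functions analytic on all of `ℝ`. -/
def analyticSubalgebra : Subalgebra ℝ (ℝ → ℝ) where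
  carrier := {g | ∀ x, AnalyticAt ℝ g x}
  mul_mem' hf hg x := (hf x).mul (hg x)
  add_mem' hf hg x := (hf x).add (hg x)
  algebraMap_mem' _ _ := analyticAt_const

theorem analyticSubalgebra_contDiffAt (g : analyticSubalgebra) (n : ℕ) (x : ℝ) :
    ContDiffAt ℝ n (g : ℝ → ℝ) x :=
  (g.2 x).contDiffAt

/-- The Taylor expansion of an analytic function at `θ`. -/
def taylorHom (θ : ℝ) : analyticSubalgebra →+* ℝ⟦X⟧ where
  toFun g := mk fun r ↦ (r.factorial : ℝ)⁻¹ * iteratedDeriv r g θ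
  map_zero' := by
    ext n
    simp
  map_one' := by
    ext n
    have : ((1 : analyticSubalgebra) : ℝ → ℝ) = fun _ ↦ 1 := rfl
    rw [coeff_mk, this, iteratedDeriv_const, coeff_one]
    split_ifs with h <;> simp [h]
  map_add' f g := by
    ext n
    simp only [coeff_mk, map_add, Subalgebra.coe_add]
    rw [iteratedDeriv_add (analyticSubalgebra_contDiffAt f n θ)
      (analyticSubalgebra_contDiffAt g n θ), mul_add]
  map_mul' f g := by
    ext n
    simp only [coeff_mk, coeff_mul, Subalgebra.coe_mul]
    rw [iteratedDeriv_mul (analyticSubalgebra_contDiffAt f n θ)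
      (analyticSubalgebra_contDiffAt g n θ), mul_sum,
      Nat.sum_antidiagonal_eq_sum_range_succ_mk]
    refine sum_congr rfl fun i hi ↦ ?_
    rw [Nat.cast_choose ℝ (Nat.lt_succ_iff.1 (mem_range.1 hi))]
    field_simp

theorem coeff_taylorHom (θ : ℝ) (g : analyticSubalgebra) (r : ℕ) :
    coeff r (taylorHom θ g) = (r.factorial : ℝ)⁻¹ * iteratedDeriv r g θ := by
  simp [taylorHom]

/-- The divided derivative `g^{(r)} / r!`. -/
def dividedDeriv (r : ℕ) (g : analyticSubalgebra) : analyticSubalgebra :=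
  ⟨fun x ↦ (r.factorial : ℝ)⁻¹ * iteratedDeriv r g x,
    fun x ↦ analyticAt_const.mul ((g.2 x).iteratedDeriv_real r)⟩

theorem coeff_taylorHom_dividedDeriv (θ : ℝ) (g : analyticSubalgebra) (r q : ℕ) :
    coeff q (taylorHom θ (dividedDeriv r g)) =
      (r + q).choose r * coeff (r + q) (taylorHom θ g) := by
  have h : iteratedDeriv q (dividedDeriv r g : ℝ → ℝ) θ =
      (r.factorial : ℝ)⁻¹ * iteratedDeriv (r + q) g θ := by
    change iteratedDeriv q (fun x ↦ (r.factorial : ℝ)⁻¹ * iteratedDeriv r g x) θ = _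
    rw [iteratedDeriv_const_mul_field]
    simp only [iteratedDeriv_eq_iterate, ← Function.iterate_add_apply, add_comm q r]
  rw [coeff_taylorHom, coeff_taylorHom, h, Nat.cast_add_choose]
  field_simp

/-- Composition of a formal series of analytic functions with `id + A`, evaluated at `θ`. -/
def composeHom (A : ℝ⟦X⟧) (hA : constantCoeff A = 0) (θ : ℝ) : analyticSubalgebra⟦X⟧ →+* ℝ⟦X⟧ :=
  diagHom (((substAlgHom (R := ℝ) (HasSubst.of_constantCoeff_zero' hA)).toRingHom).comp
    (taylorHom θ))

theorem coeff_composeHom (A : ℝ⟦X⟧) (hA : constantCoeff A = 0) (θ : ℝ)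
    (Φ : analyticSubalgebra⟦X⟧) (n : ℕ) :
    coeff n (composeHom A hA θ Φ) =
      ∑ p ∈ antidiagonal n, coeff p.2 ((taylorHom θ (coeff p.1 Φ)).subst A) := by
  rw [composeHom, coeff_diagHom]
  simp [coe_substAlgHom]

theorem composeHom_C (A : ℝ⟦X⟧) (hA : constantCoeff A = 0) (θ : ℝ) (g : analyticSubalgebra) :
    composeHom A hA θ (C g) = (taylorHom θ g).subst A := by
  rw [composeHom, diagHom_C]
  simp [coe_substAlgHom]

theorem composeHom_X (A : ℝ⟦X⟧) (hA : constantCoeff A = 0) (θ : ℝ) :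
    composeHom A hA θ X = X :=
  diagHom_X _

theorem coeff_composeHom_eq_compCoeff (a : ℕ → ℝ → ℝ) (θ : ℝ)
    (hA : constantCoeff (PowerSeries.mk (a · θ)) = 0) (Φ : analyticSubalgebra⟦X⟧) (n : ℕ) :
    coeff n (composeHom (PowerSeries.mk (a · θ)) hA θ Φ) =
      compCoeff (fun s ↦ (coeff s Φ : analyticSubalgebra)) a n θ := by
  rw [coeff_composeHom, compCoeff, Nat.sum_antidiagonal_eq_sum_range_succ_mk]
  refine sum_congr rfl fun s _ ↦ ?_
  rw [coeff_subst_eq_sum_range hA _ (Nat.lt_succ_self _)]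
  refine sum_congr rfl fun r _ ↦ ?_
  simp [coeff_taylorHom, coeff_pow_eq_sum_antidiagonalTuple]

theorem rhsCoeff_succ_eq_coeff_subst (f : analyticSubalgebra) (u : ℕ → ℝ → ℝ) (θ : ℝ)
    (hU : constantCoeff (PowerSeries.mk (u · θ)) = 0) (n : ℕ) :
    rhsCoeff f u (n + 1) θ =
      coeff n ((taylorHom θ f).subst (PowerSeries.mk (u · θ))) := by
  rw [rhsCoeff, coeff_subst_eq_sum_range hU _ (Nat.lt_succ_self _)]
  refine sum_congr rfl fun r _ ↦ ?_
  simp [coeff_taylorHom, coeff_pow_eq_sum_antidiagonalTuple]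

/-- Evaluation of analytic functions at a point. -/
def evalHom (x : ℝ) : analyticSubalgebra →+* ℝ :=
  (Pi.evalRingHom (fun _ : ℝ ↦ ℝ) x).comp analyticSubalgebra.val.toRingHom

theorem constantCoeff_composeHom (A : ℝ⟦X⟧) (hA : constantCoeff A = 0) (θ : ℝ)
    (U : analyticSubalgebra⟦X⟧) (hU : constantCoeff U = 0) :
    constantCoeff (composeHom A hA θ U) = 0 := by
  obtain ⟨W, rfl⟩ := X_dvd_iff.2 hU
  simp [composeHom_X]

/-- Associativity of formal composition:
`(f ∘ (id + U)) ∘ (id + A) = f ∘ (id + A + U ∘ (id + A))`. -/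
theorem composeHom_comp (A : ℝ⟦X⟧) (hA : constantCoeff A = 0) (θ : ℝ)
    (f : analyticSubalgebra) (U G : analyticSubalgebra⟦X⟧) (hU : constantCoeff U = 0)
    (hG : ∀ x, map (evalHom x) G = (taylorHom x f).subst (map (evalHom x) U)) :
    composeHom A hA θ G = (taylorHom θ f).subst (A + composeHom A hA θ U) := by
  have hV := constantCoeff_composeHom A hA θ U hU
  ext n
  have h₁ : (X : analyticSubalgebra⟦X⟧) ^ (n + 1) ∣
      G - ∑ r ∈ range (n + 1), C (dividedDeriv r f) * U ^ r := by
    refine X_pow_dvd_iff.2 fun k hk ↦ ?_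
    ext x
    have hUx : constantCoeff (map (evalHom x) U) = 0 := by
      rw [← coeff_zero_eq_constantCoeff_apply, coeff_map, coeff_zero_eq_constantCoeff_apply, hU,
        map_zero]
    have h := congrArg (coeff k) (hG x)
    rw [coeff_subst_eq_sum_range hUx _ hk] at h
    change evalHom x (coeff k (G - ∑ r ∈ range (n + 1), C (dividedDeriv r f) * U ^ r)) =
      evalHom x 0
    simp only [map_sub, map_sum, coeff_C_mul, map_mul, map_zero, sub_eq_zero]
    rw [← coeff_map, h]
    refine sum_congr rfl fun r _ ↦ ?_
    rw [← map_pow, coeff_map, coeff_taylorHom]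
    rfl
  have h₂ := map_dvd (composeHom A hA θ) h₁
  simp only [map_pow, composeHom_X, map_sub, map_sum, map_mul, composeHom_C] at h₂
  have h₃ := X_pow_dvd_subst_add_sub hA hV (taylorHom θ f) (fun r ↦ taylorHom θ (dividedDeriv r f))
    (coeff_taylorHom_dividedDeriv θ f) (n + 1)
  have h₄ := dvd_sub h₂ h₃
  rw [sub_sub_sub_cancel_right] at h₄
  simpa [sub_eq_zero] using X_pow_dvd_iff.1 h₄ n (Nat.lt_succ_self n)

theorem analyticAt_compCoeff {φ a : ℕ → ℝ → ℝ} {n : ℕ} {x : ℝ}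
    (hφ : ∀ s, AnalyticAt ℝ (φ s) x) (ha : ∀ s, AnalyticAt ℝ (a s) x) :
    AnalyticAt ℝ (compCoeff φ a n) x := by
  unfold compCoeff
  refine Finset.analyticAt_fun_sum _ fun s _ ↦ Finset.analyticAt_fun_sum _ fun r _ ↦ ?_
  exact (analyticAt_const.mul ((hφ s).iteratedDeriv_real r)).mul
    (Finset.analyticAt_fun_sum _ fun c _ ↦ Finset.analyticAt_fun_prod _ fun i _ ↦ ha _)

theorem analyticAt_rhsCoeff {f : ℝ → ℝ} {u : ℕ → ℝ → ℝ} {n : ℕ} {x : ℝ}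
    (hf : AnalyticAt ℝ f x) (hu : ∀ s, AnalyticAt ℝ (u s) x) :
    AnalyticAt ℝ (rhsCoeff f u n) x := by
  unfold rhsCoeff
  refine Finset.analyticAt_fun_sum _ fun r _ ↦ ?_
  exact (analyticAt_const.mul (hf.iteratedDeriv_real r)).mul
    (Finset.analyticAt_fun_sum _ fun c _ ↦ Finset.analyticAt_fun_prod _ fun i _ ↦ hu _)

theorem compCoeff_add_const {a : ℕ → ℝ → ℝ} {c : ℝ} (ha : ∀ n x, a n (x + c) = a n x)
    (φ : ℕ → ℝ → ℝ) (n : ℕ) (θ : ℝ) :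
    compCoeff φ a n (θ + c) = compCoeff (fun s x ↦ φ s (x + c)) a n θ := by
  simp only [compCoeff, ha, iteratedDeriv_comp_add_const]

theorem compCoeff_sum {ι : Type*} (t : Finset ι) (b : ι → ℝ) {φ : ι → ℕ → ℝ → ℝ} {θ : ℝ}
    (hφ : ∀ i s, AnalyticAt ℝ (φ i s) θ) (a : ℕ → ℝ → ℝ) (n : ℕ) :
    compCoeff (fun s x ↦ ∑ i ∈ t, b i * φ i s x) a n θ = ∑ i ∈ t, b i * compCoeff (φ i) a n θ := by
  have h (r s : ℕ) : iteratedDeriv r (fun x ↦ ∑ i ∈ t, b i * φ i s x) θ =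
      ∑ i ∈ t, b i * iteratedDeriv r (φ i s) θ := by
    have hb (i : ι) : AnalyticAt ℝ (fun x ↦ b i * φ i s x) θ := analyticAt_const.mul (hφ i s)
    rw [iteratedDeriv_fun_sum fun i _ ↦ (hb i).contDiffAt]
    simp only [iteratedDeriv_const_mul_field]
  simp only [compCoeff, h]
  simp only [mul_sum (s := range _), mul_sum (s := t), sum_mul (s := t)]
  rw [sum_comm (s := t)]
  refine sum_congr rfl fun s _ ↦ ?_
  rw [sum_comm (s := t)]
  exact sum_congr rfl fun r _ ↦ sum_congr rfl fun i _ ↦ by ring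

theorem compCoeff_sub {φ ψ : ℕ → ℝ → ℝ} {θ : ℝ} (hφ : ∀ s, AnalyticAt ℝ (φ s) θ)
    (hψ : ∀ s, AnalyticAt ℝ (ψ s) θ) (a : ℕ → ℝ → ℝ) (n : ℕ) :
    compCoeff (fun s x ↦ φ s x - ψ s x) a n θ = compCoeff φ a n θ - compCoeff ψ a n θ := by
  have h := compCoeff_sum univ ![1, -1] (φ := ![φ, ψ]) (θ := θ)
    (fun i s ↦ by fin_cases i <;> simp [hφ, hψ]) a n
  simpa [Fin.sum_univ_two, ← sub_eq_add_neg] using h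

theorem compCoeff_zero_left (a : ℕ → ℝ → ℝ) (n : ℕ) (θ : ℝ) :
    compCoeff (fun _ _ ↦ 0) a n θ = 0 := by
  simp [compCoeff]

theorem compCoeff_zero_right (φ a : ℕ → ℝ → ℝ) (θ : ℝ) : compCoeff φ a 0 θ = φ 0 θ := by
  simp [compCoeff]

theorem compCoeff_congr_right {φ a b : ℕ → ℝ → ℝ} {n : ℕ} (hφ : φ 0 = 0)
    (h : ∀ k < n, a k = b k) : compCoeff φ a n = compCoeff φ b n := by
  funext θ
  refine sum_congr rfl fun s _ ↦ sum_congr rfl fun r _ ↦ ?_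
  rcases Nat.eq_zero_or_pos s with rfl | hs
  · simp [hφ]
  · congr 1
    refine sum_congr rfl fun c hc ↦ prod_congr rfl fun i _ ↦ ?_
    rcases Nat.eq_zero_or_pos n with rfl | hn
    · simp_all
    · have := single_le_sum (fun j _ ↦ Nat.zero_le (c j)) (mem_univ i)
      rw [Nat.mem_antidiagonalTuple.1 hc] at this
      rw [h (c i) (by omega)]

/-- The series `a` such that `id + a` is the right composition inverse of `id + φ`. -/
def compInverse (φ : ℕ → ℝ → ℝ) : ℕ → ℝ → ℝ
  | n => fun θ ↦ if n = 0 then 0 else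
      -compCoeff φ (fun k ↦ if _ : k < n then compInverse φ k else 0) n θ

theorem compInverse_zero (φ : ℕ → ℝ → ℝ) : compInverse φ 0 = 0 := by
  rw [compInverse]
  simp [Pi.zero_def]

theorem compInverse_eq {φ : ℕ → ℝ → ℝ} (hφ : φ 0 = 0) (n : ℕ) :
    compInverse φ n = fun θ ↦ -compCoeff φ (compInverse φ) n θ := by
  funext θ
  rcases Nat.eq_zero_or_pos n with rfl | hn
  · simp [compInverse_zero, compCoeff_zero_right, hφ]
  · rw [compInverse]
    simp only [hn.ne', if_false]
    congr 1
    exact congrFun (compCoeff_congr_right hφ fun k hk ↦ by simp [hk]) θ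

theorem compInverse_add_const {φ : ℕ → ℝ → ℝ} {c : ℝ} (hφ : ∀ n x, φ n (x + c) = φ n x)
    (n : ℕ) (x : ℝ) : compInverse φ n (x + c) = compInverse φ n x := by
  induction n using Nat.strong_induction_on generalizing x with
  | _ n ih =>
    rw [compInverse]
    beta_reduce
    congr 2
    rw [compCoeff_add_const]
    · simp only [hφ]
    · intro k x
      split_ifs with hk
      · exact ih k hk x
      · rfl

theorem analyticAt_compInverse {φ : ℕ → ℝ → ℝ} {x : ℝ} (hφ : ∀ n, AnalyticAt ℝ (φ n) x) (n : ℕ) :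
    AnalyticAt ℝ (compInverse φ n) x := by
  induction n using Nat.strong_induction_on with
  | _ n ih =>
    rw [compInverse]
    split_ifs with hn
    · exact analyticAt_const
    · refine (analyticAt_compCoeff hφ fun k ↦ ?_).neg
      split_ifs with hk
      · exact ih k hk
      · exact analyticAt_const

theorem periodic_add_int_mul {g : ℝ → ℝ} {c : ℝ} (hg : ∀ x, g (x + c) = g x) (k : ℤ) (x : ℝ) :
    g (x + k * c) = g x :=
  (show Function.Periodic g c from hg).int_mul k x

section P0

variable {m : ℕ} {g : ℝ → ℝ}

theorem analyticAt_P0 (hg : ∀ x, AnalyticAt ℝ g x) (x : ℝ) : AnalyticAt ℝ (P0 m g) x :=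
  analyticAt_const.mul <| Finset.analyticAt_fun_sum _ fun _ _ ↦
    (hg _).fun_comp (analyticAt_id.add analyticAt_const)

theorem P0_add_inv (hm : 0 < m) (hg : ∀ x, g (x + 1) = g x) (x : ℝ) :
    P0 m g (x + 1 / m) = P0 m g x := by
  have hm' : (m : ℝ) ≠ 0 := by positivity
  have h : ∀ j : ℕ, g (x + 1 / m + (j : ℝ) / m) = g (x + ((j + 1 : ℕ) : ℝ) / m) := fun _ ↦ by
    congr 1
    push_cast
    ring
  simp only [P0, h]
  congr 1
  have h₁ := sum_range_succ' (fun j : ℕ ↦ g (x + (j : ℝ) / m)) m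
  rw [sum_range_succ, div_self hm', hg] at h₁
  simpa using h₁.symm

theorem P0_of_add_inv (hm : 0 < m) (hg : ∀ x, g (x + 1 / m) = g x) (x : ℝ) : P0 m g x = g x := by
  have hm' : (m : ℝ) ≠ 0 := by positivity
  have h (j : ℕ) : g (x + (j : ℝ) / m) = g x := by
    simpa [div_eq_mul_inv] using periodic_add_int_mul hg j x
  simp [P0, h, hm']

theorem P0_sub (g₁ g₂ : ℝ → ℝ) (x : ℝ) :
    P0 m (fun y ↦ g₁ y - g₂ y) x = P0 m g₁ x - P0 m g₂ x := by
  simp [P0, sum_sub_distrib, mul_sub]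

theorem P0_compCoeff {φ a : ℕ → ℝ → ℝ} (hφ : ∀ s x, AnalyticAt ℝ (φ s) x)
    (ha : ∀ n x, a n (x + 1 / m) = a n x) (n : ℕ) (θ : ℝ) :
    P0 m (compCoeff φ a n) θ = compCoeff (fun s ↦ P0 m (φ s)) a n θ := by
  have ha' (j : ℕ) (k : ℕ) (x : ℝ) : a k (x + (j : ℝ) / m) = a k x := by
    simpa [div_eq_mul_inv] using periodic_add_int_mul (ha k) j x
  have h := compCoeff_sum (range m) (fun _ ↦ (m : ℝ)⁻¹) (φ := fun j s x ↦ φ s (x + (j : ℝ) / m))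
    (θ := θ) (fun j s ↦ (hφ s _).fun_comp (analyticAt_id.add analyticAt_const)) a n
  simp only [← mul_sum] at h
  rw [P0]
  simp only [compCoeff_add_const (ha' _)]
  exact h.symm

end P0

/-- If `id + a` is a right composition inverse of `id + v`, then
`(ε f ∘ (id + u)) ∘ (id + a) = ε f ∘ (id + w)` for `w = (u - v) ∘ (id + a)`. -/
theorem compCoeff_rhsCoeff {f : ℝ → ℝ} {u v a w : ℕ → ℝ → ℝ}
    (hf : ∀ x, AnalyticAt ℝ f x) (hu : ∀ n x, AnalyticAt ℝ (u n) x)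
    (hv : ∀ n x, AnalyticAt ℝ (v n) x) (hu0 : u 0 = 0) (hv0 : v 0 = 0) (ha0 : a 0 = 0)
    (hav : ∀ n θ, a n θ = -compCoeff v a n θ)
    (hw : ∀ n θ, w n θ = compCoeff (fun s x ↦ u s x - v s x) a n θ) (n : ℕ) (θ : ℝ) :
    compCoeff (rhsCoeff f u) a n θ = rhsCoeff f w n θ := by
  let F : analyticSubalgebra := ⟨f, hf⟩
  let U : analyticSubalgebra⟦X⟧ := PowerSeries.mk fun n ↦ ⟨u n, hu n⟩
  let G : analyticSubalgebra⟦X⟧ :=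
    PowerSeries.mk fun n ↦ ⟨rhsCoeff f u (n + 1), fun x ↦ analyticAt_rhsCoeff (hf x) (hu · x)⟩
  have hA : constantCoeff (PowerSeries.mk (a · θ)) = 0 := by simp [ha0]
  have hw0 : constantCoeff (PowerSeries.mk (w · θ)) = 0 := by
    simp [hw, compCoeff_zero_right, hu0, hv0]
  have hU : constantCoeff U = 0 := by
    ext x
    simp [U, hu0]
  have hwU : PowerSeries.mk (w · θ) = PowerSeries.mk (a · θ) + composeHom _ hA θ U := by
    ext k
    rw [coeff_mk, map_add, coeff_mk, coeff_composeHom_eq_compCoeff, hw,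
      compCoeff_sub (hu · θ) (hv · θ), hav]
    simp only [U, coeff_mk]
    ring
  have hG (x : ℝ) : map (evalHom x) G = (taylorHom x F).subst (map (evalHom x) U) := by
    have hUx : map (evalHom x) U = PowerSeries.mk (u · x) := by
      ext k
      simp [U, evalHom]
    ext k
    rw [hUx, ← rhsCoeff_succ_eq_coeff_subst F u x (by simp [hu0])]
    simp [G, F, evalHom]
  have hXG (s : ℕ) : ((coeff s (X * G) : analyticSubalgebra) : ℝ → ℝ) = rhsCoeff f u s := by
    cases s with
    | zero => funext x; simp [rhsCoeff]
    | succ s => simp [coeff_succ_X_mul, G]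
  have h := coeff_composeHom_eq_compCoeff a θ hA (X * G) n
  simp only [hXG] at h
  rw [← h, map_mul, composeHom_X, composeHom_comp _ hA θ F U G hU hG, ← hwU]
  cases n with
  | zero => simp [rhsCoeff]
  | succ n => rw [coeff_succ_X_mul, ← rhsCoeff_succ_eq_coeff_subst F w θ hw0]

end FormalComposition

/-- Reduction lemma: for any formal solution
`u ∈ ε·C^ω(𝕋)[[ε]]` of `Δ*u = εf∘(id+u)` with `ω* = p/m`, the series `id+Π₀u`
has a composition inverse `id+a` with `a ∈ ε·V₀[[ε]]`, and
`u* = (u−Π₀u)∘(id+a)` is again a formal solution of the same equation, with all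
its coefficients in `V₀^⊥`. -/
theorem reduction_to_V0perp (p : ℤ) (m : ℕ) (hm : 0 < m) (f : ℝ → ℝ)
    (hfa : ∀ x : ℝ, AnalyticAt ℝ f x)
    (hfper : ∀ x : ℝ, f (x + 1) = f x)
    (hfmean : (∫ t in (0:ℝ)..1, f t) = 0)
    (u : ℕ → ℝ → ℝ)
    (hu0 : u 0 = 0)
    (hua : ∀ n : ℕ, ∀ x : ℝ, AnalyticAt ℝ (u n) x)
    (huper : ∀ n : ℕ, ∀ x : ℝ, u n (x + 1) = u n x)
    (hueq : ∀ n : ℕ, 1 ≤ n → ∀ θ : ℝ,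
      u n (θ + (p : ℝ) / m) - 2 * u n θ + u n (θ - (p : ℝ) / m) = rhsCoeff f u n θ) :
    ∃ a : ℕ → ℝ → ℝ,
      a 0 = 0 ∧
      -- `a ∈ ε·V₀[[ε]]`, with analytic coefficients:
      (∀ n : ℕ, (∀ x : ℝ, AnalyticAt ℝ (a n) x) ∧
        (∀ x : ℝ, a n (x + 1) = a n x) ∧
        (∀ x : ℝ, a n (x + 1 / m) = a n x)) ∧
      -- `(id+Π₀u)∘(id+a) = id` as formal series:
      (∀ n : ℕ, 1 ≤ n → ∀ θ : ℝ,
        a n θ + compCoeff (fun s => P0 m (u s)) a n θ = 0) ∧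
      -- `u* = (u−Π₀u)∘(id+a)` is a formal solution with coefficients in `V₀^⊥`:
      ∀ ustar : ℕ → ℝ → ℝ,
        (∀ n : ℕ, ∀ θ : ℝ,
          ustar n θ = compCoeff (fun s θ' => u s θ' - P0 m (u s) θ') a n θ) →
        (∀ n : ℕ, (∀ x : ℝ, AnalyticAt ℝ (ustar n) x) ∧
          (∀ x : ℝ, ustar n (x + 1) = ustar n x) ∧
          (∀ θ : ℝ, P0 m (ustar n) θ = 0)) ∧
        (∀ n : ℕ, 1 ≤ n → ∀ θ : ℝ,
          ustar n (θ + (p : ℝ) / m) - 2 * ustar n θ + ustar n (θ - (p : ℝ) / m) =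
            rhsCoeff f ustar n θ) := by
  set v : ℕ → ℝ → ℝ := fun s ↦ P0 m (u s) with hv
  have hv0 : v 0 = 0 := by
    funext x
    simp [hv, P0, hu0]
  have hva (n : ℕ) (x : ℝ) : AnalyticAt ℝ (v n) x := analyticAt_P0 (hua n) x
  have hvper (n : ℕ) (x : ℝ) : v n (x + 1 / m) = v n x :=
    P0_add_inv hm (huper n) x
  set a := compInverse v
  have haa (n : ℕ) (x : ℝ) : AnalyticAt ℝ (a n) x := analyticAt_compInverse (hva · x) n
  have haper (n : ℕ) (x : ℝ) : a n (x + 1 / m) = a n x := compInverse_add_const hvper n x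
  have haper1 (n : ℕ) (x : ℝ) : a n (x + 1) = a n x := by
    have := periodic_add_int_mul (haper n) m x
    rwa [Int.cast_natCast, mul_one_div_cancel (by positivity)] at this
  have hper {g : ℝ → ℝ} (hg : ∀ x, g (x + 1 / m) = g x) (x : ℝ) :
      g (x + (p : ℝ) / m) = g x := by
    simpa [div_eq_mul_inv] using periodic_add_int_mul hg p x
  have hper' {g : ℝ → ℝ} (hg : ∀ x, g (x + 1 / m) = g x) (x : ℝ) :
      g (x + -((p : ℝ) / m)) = g x := by
    rw [← hper hg (x + -((p : ℝ) / m)), neg_add_cancel_right]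
  have hav (n : ℕ) (θ : ℝ) : a n θ = -compCoeff v a n θ := congrFun (compInverse_eq hv0 n) θ
  refine ⟨a, compInverse_zero v, fun n ↦ ⟨haa n, haper1 n, haper n⟩,
    fun n _ θ ↦ by rw [hav]; exact neg_add_cancel _, fun w hw ↦ ?_⟩
  set d : ℕ → ℝ → ℝ := fun s θ ↦ u s θ - v s θ
  have hda (n : ℕ) (x : ℝ) : AnalyticAt ℝ (d n) x := (hua n x).sub (hva n x)
  have hw' (n : ℕ) : w n = compCoeff d a n := funext (hw n)
  refine ⟨fun n ↦ ⟨fun x ↦ ?_, fun x ↦ ?_, fun θ ↦ ?_⟩, fun n hn θ ↦ ?_⟩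
  · rw [hw']
    exact analyticAt_compCoeff (hda · x) (haa · x)
  · rw [hw', compCoeff_add_const haper1]
    have (s : ℕ) (y : ℝ) : v s (y + 1) = v s y := by
      simp only [hv, P0, add_right_comm y 1, huper]
    simp only [d, this, huper]
  · rw [hw', P0_compCoeff hda haper]
    have (s : ℕ) : P0 m (d s) = fun _ ↦ 0 := by
      funext x
      rw [P0_sub, P0_of_add_inv hm (hvper s), sub_self]
    simp only [this, compCoeff_zero_left]
  · have hΔ (s : ℕ) (x : ℝ) : d s (x + p / m) + -2 * d s x + d s (x + -(p / m)) =
        rhsCoeff f u s x := by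
      simp only [d, hper (hvper s), hper' (hvper s)]
      rcases Nat.eq_zero_or_pos s with rfl | hs
      · simp [rhsCoeff, hu0, hv0]
      · rw [← hueq s hs x, sub_eq_add_neg x]
        ring
    have hshift (c : ℝ) (s : ℕ) (x : ℝ) : AnalyticAt ℝ (fun y ↦ d s (y + c)) x :=
      (hda s _).fun_comp (analyticAt_id.add analyticAt_const)
    have h := compCoeff_sum Finset.univ ![1, -2, 1]
      (φ := ![fun s x ↦ d s (x + p / m), d, fun s x ↦ d s (x + -(p / m))]) (θ := θ)
      (fun i s ↦ by fin_cases i; exacts [hshift _ s θ, hda s θ, hshift _ s θ]) a n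
    simp only [Fin.sum_univ_three, Matrix.cons_val, one_mul, hΔ] at h
    rw [← compCoeff_rhsCoeff hfa hua hva hu0 hv0 (compInverse_zero v) hav hw, sub_eq_add_neg θ,
      hw', compCoeff_add_const (fun n ↦ hper (haper n)),
      compCoeff_add_const (fun n ↦ hper' (haper n))]
    refine Eq.trans ?_ h.symm
    ring
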